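/- arXiv:2006.15328 — 2 statements merged into one kernel-verified Lean document; each statement's English description precedes it below -/
import Mathlib

section
/- Let G ⊆ ℝ² be open and let F be a family of real-valued functions on G, each C¹ on G and monotone in the sense of Lebesgue on every closed disc contained in G. Suppose that for every open set D with compact closure contained in G there is a constant M_D < ∞ such that ∫∫_D |∇f|² dx ≤ M_D for every f ∈ F. Then F is equicontinuous on every compact subset of G: for every compact D ⊆ G and every ε > 0 there is δ > 0 such that |f(x) − f(y)| < ε whenever f ∈ F, x, y ∈ D and |x − y| < δ. -/
open Set Metric MeasureTheory
open scoped RealInnerProductSpace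

noncomputable section

abbrev E2 : Type := EuclideanSpace ℝ (Fin 2)

/-- The oscillation of `f` over a set `S`: `osc_S f = sup_S f − inf_S f`. -/
def osc (f : E2 → ℝ) (S : Set E2) : ℝ := sSup (f '' S) - sInf (f '' S)

/-- The oscillation over a compact set is attained. -/
lemma IsCompact.exists_osc_eq {f : E2 → ℝ} {S : Set E2} (hS : IsCompact S) (hne : S.Nonempty)
    (hf : ContinuousOn f S) : ∃ p ∈ S, ∃ q ∈ S, osc f S = f p - f q := by
  obtain ⟨p, hp, hp'⟩ := (hS.image_of_continuousOn hf).sSup_mem (hne.image f)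
  obtain ⟨q, hq, hq'⟩ := (hS.image_of_continuousOn hf).sInf_mem (hne.image f)
  exact ⟨p, hp, q, hq, by rw [osc, hp', hq']⟩

lemma IsCompact.sub_le_osc {f : E2 → ℝ} {S : Set E2} (hS : IsCompact S)
    (hf : ContinuousOn f S) {p q : E2} (hp : p ∈ S) (hq : q ∈ S) : f p - f q ≤ osc f S :=
  sub_le_sub (le_csSup (hS.image_of_continuousOn hf).bddAbove (mem_image_of_mem f hp))
    (csInf_le (hS.image_of_continuousOn hf).bddBelow (mem_image_of_mem f hq))

lemma IsCompact.abs_sub_le_osc {f : E2 → ℝ} {S : Set E2} (hS : IsCompact S)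
    (hf : ContinuousOn f S) {p q : E2} (hp : p ∈ S) (hq : q ∈ S) : |f p - f q| ≤ osc f S :=
  abs_sub_le_iff.2 ⟨hS.sub_le_osc hf hp hq, hS.sub_le_osc hf hq hp⟩

lemma IsCompact.osc_mono {f : E2 → ℝ} {S T : Set E2} (hT : IsCompact T) (hS : IsCompact S)
    (hne : S.Nonempty) (hST : S ⊆ T) (hf : ContinuousOn f T) : osc f S ≤ osc f T := by
  obtain ⟨p, hp, q, hq, h⟩ := hS.exists_osc_eq hne (hf.mono hST)
  exact h ▸ hT.sub_le_osc hf (hST hp) (hST hq)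

/-- Cauchy–Schwarz inequality on an interval. -/
lemma sq_intervalIntegral_le {u : ℝ → ℝ} (hu : Continuous u) {a b : ℝ} (hab : a < b) :
    (∫ t in a..b, u t) ^ 2 ≤ (b - a) * ∫ t in a..b, u t ^ 2 := by
  set A := ∫ t in a..b, u t with hA
  have hba : 0 < b - a := sub_pos.2 hab
  have h0 : 0 ≤ ∫ t in a..b, (u t - A / (b - a)) ^ 2 :=
    intervalIntegral.integral_nonneg hab.le fun t _ => sq_nonneg _
  have h1 : ∫ t in a..b, (u t - A / (b - a)) ^ 2
      = (∫ t in a..b, u t ^ 2) - 2 * (A / (b - a)) * A + (b - a) * (A / (b - a)) ^ 2 := by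
    have : ∀ t, (u t - A / (b - a)) ^ 2
        = u t ^ 2 - 2 * (A / (b - a)) * u t + (A / (b - a)) ^ 2 := fun t => by ring
    simp_rw [this]
    rw [intervalIntegral.integral_add, intervalIntegral.integral_sub,
      intervalIntegral.integral_const_mul, intervalIntegral.integral_const, smul_eq_mul]
    all_goals exact Continuous.intervalIntegrable (by fun_prop) _ _
  have h2 : (b - a) * ((∫ t in a..b, u t ^ 2) - 2 * (A / (b - a)) * A
      + (b - a) * (A / (b - a)) ^ 2) = (b - a) * (∫ t in a..b, u t ^ 2) - A ^ 2 := by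
    field_simp
    ring
  have h3 := mul_nonneg hba.le (h1 ▸ h0)
  linarith

/-- The point of the plane with polar coordinates `p` centred at `x`. -/
def polarPoint (x : E2) (p : ℝ × ℝ) : E2 :=
  x + Complex.orthonormalBasisOneI.repr (Complex.polarCoord.symm p)

lemma continuous_polarPoint (x : E2) : Continuous (polarPoint x) := by
  unfold polarPoint
  simp_rw [Complex.polarCoord_symm_apply]
  fun_prop

lemma dist_polarPoint (x : E2) (p : ℝ × ℝ) : dist (polarPoint x p) x = |p.1| := by
  simp [polarPoint, dist_eq_norm]

lemma exists_polarPoint_eq {x p : E2} {r : ℝ} (hp : p ∈ sphere x r) :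
    ∃ θ ∈ Icc (-Real.pi) Real.pi, polarPoint x (r, θ) = p := by
  set z : ℂ := Complex.orthonormalBasisOneI.repr.symm (p - x) with hz
  have hr : ‖z‖ = r := by
    rw [hz, LinearIsometryEquiv.norm_map, ← dist_eq_norm]
    exact hp
  refine ⟨z.arg, ⟨(Complex.neg_pi_lt_arg z).le, Complex.arg_le_pi z⟩, ?_⟩
  have : Complex.polarCoord.symm (r, z.arg) = z := by
    rw [Complex.polarCoord_symm_apply, ← hr]
    simp only [Complex.ofReal_cos, Complex.ofReal_sin]
    exact Complex.norm_mul_cos_add_sin_mul_I z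
  rw [polarPoint, this, hz, LinearIsometryEquiv.apply_symm_apply, add_sub_cancel]

lemma hasDerivAt_polarPoint (x : E2) (r θ : ℝ) :
    ∃ v : E2, ‖v‖ = |r| ∧ HasDerivAt (fun t => polarPoint x (r, t)) v θ := by
  refine ⟨Complex.orthonormalBasisOneI.repr
    ((r : ℂ) * (Complex.exp (θ * Complex.I) * Complex.I)), ?_, ?_⟩
  · simp [Complex.norm_exp_ofReal_mul_I]
  · have h1 : HasDerivAt (fun t : ℝ => (r : ℂ) * Complex.exp (t * Complex.I))
        ((r : ℂ) * (Complex.exp (θ * Complex.I) * Complex.I)) θ := by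
      refine HasDerivAt.const_mul _ (HasDerivAt.cexp ?_)
      simpa using (Complex.ofRealCLM.hasDerivAt (x := θ)).mul_const Complex.I
    have h2 := (Complex.orthonormalBasisOneI.repr.toContinuousLinearEquiv.hasFDerivAt
      (x := (r : ℂ) * Complex.exp (θ * Complex.I))).comp_hasDerivAt θ h1
    refine (h2.const_add x).congr_of_eventuallyEq (Filter.Eventually.of_forall fun t => ?_)
    simp [polarPoint, Complex.exp_mul_I]

/-- The oscillation over a circle is controlled by the square integral of the derivative. -/
lemma sq_osc_sphere_le {G : Set E2} (hG : IsOpen G) {f : E2 → ℝ} (hf : ContDiffOn ℝ 1 f G)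
    {x : E2} {r : ℝ} (hr : 0 < r) (hxr : closedBall x r ⊆ G) :
    osc f (sphere x r) ^ 2 ≤ 2 * Real.pi * r ^ 2 *
      ∫ θ in -Real.pi..Real.pi, ‖fderiv ℝ f (polarPoint x (r, θ))‖ ^ 2 := by
  have hmem : ∀ θ, polarPoint x (r, θ) ∈ G := fun θ => hxr <| by
    rw [mem_closedBall, dist_polarPoint, abs_of_pos hr]
  have hcont : Continuous fun θ => ‖fderiv ℝ f (polarPoint x (r, θ))‖ :=
    ((hf.continuousOn_fderiv_of_isOpen hG le_rfl).comp_continuous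
      ((continuous_polarPoint x).comp (by fun_prop)) hmem).norm
  have hpi : -Real.pi < Real.pi := by linarith [Real.pi_pos]
  choose v hv hv' using hasDerivAt_polarPoint x r
  have hderiv : ∀ θ, HasDerivAt (fun t => f (polarPoint x (r, t)))
      (fderiv ℝ f (polarPoint x (r, θ)) (v θ)) θ := fun θ =>
    ((hf.differentiableOn one_ne_zero).differentiableAt
      (hG.mem_nhds (hmem θ))).hasFDerivAt.comp_hasDerivAt θ (hv' θ)
  have hbd : ∀ θ, ‖fderiv ℝ f (polarPoint x (r, θ)) (v θ)‖
      ≤ r * ‖fderiv ℝ f (polarPoint x (r, θ))‖ := fun θ => by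
    refine (ContinuousLinearMap.le_opNorm _ _).trans_eq ?_
    rw [hv, abs_of_pos hr, mul_comm]
  have hint : IntervalIntegrable (fun θ => r * ‖fderiv ℝ f (polarPoint x (r, θ))‖) volume
      (-Real.pi) Real.pi := (continuous_const.mul hcont).intervalIntegrable _ _
  have hkey : ∀ a ∈ Icc (-Real.pi) Real.pi, ∀ b ∈ Icc (-Real.pi) Real.pi, a ≤ b →
      |f (polarPoint x (r, b)) - f (polarPoint x (r, a))| ≤
        ∫ θ in -Real.pi..Real.pi, r * ‖fderiv ℝ f (polarPoint x (r, θ))‖ := by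
    intro a ha b hb hab
    have h1 : |f (polarPoint x (r, b)) - f (polarPoint x (r, a))| ≤
        ∫ θ in a..b, r * ‖fderiv ℝ f (polarPoint x (r, θ))‖ := by
      have hci : IntervalIntegrable (fun θ => fderiv ℝ f (polarPoint x (r, θ)) (v θ))
          volume a b := by
        refine ((continuous_const.mul hcont).intervalIntegrable a b).mono_fun ?_
          (Filter.Eventually.of_forall fun θ => (hbd θ).trans (le_abs_self _))
        have : (fun θ => fderiv ℝ f (polarPoint x (r, θ)) (v θ))
            = deriv fun t => f (polarPoint x (r, t)) := funext fun θ => (hderiv θ).deriv.symm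
        rw [this]
        exact (measurable_deriv _).aestronglyMeasurable
      rw [← intervalIntegral.integral_eq_sub_of_hasDerivAt (fun θ _ => hderiv θ) hci,
        ← Real.norm_eq_abs]
      exact intervalIntegral.norm_integral_le_of_norm_le hab
        (Filter.Eventually.of_forall fun θ _ => hbd θ)
        ((continuous_const.mul hcont).intervalIntegrable a b)
    refine h1.trans (intervalIntegral.integral_mono_interval ha.1 hab hb.2 ?_ hint)
    exact Filter.Eventually.of_forall fun θ => by dsimp; positivity
  have hsub : sphere x r ⊆ G := sphere_subset_closedBall.trans hxr
  obtain ⟨p, hp, q, hq, hpq⟩ := (isCompact_sphere x r).exists_osc_eq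
    (NormedSpace.sphere_nonempty.2 hr.le) (hf.continuousOn.mono hsub)
  obtain ⟨b, hb, rfl⟩ := exists_polarPoint_eq hp
  obtain ⟨a, ha, rfl⟩ := exists_polarPoint_eq hq
  have hle : |osc f (sphere x r)| ≤
      ∫ θ in -Real.pi..Real.pi, r * ‖fderiv ℝ f (polarPoint x (r, θ))‖ := by
    rw [hpq]
    rcases le_total a b with hab | hab
    · exact hkey a ha b hb hab
    · rw [abs_sub_comm]
      exact hkey b hb a ha hab
  calc osc f (sphere x r) ^ 2
      = |osc f (sphere x r)| ^ 2 := (sq_abs _).symm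
    _ ≤ (∫ θ in -Real.pi..Real.pi, r * ‖fderiv ℝ f (polarPoint x (r, θ))‖) ^ 2 := by gcongr
    _ = r ^ 2 * (∫ θ in -Real.pi..Real.pi, ‖fderiv ℝ f (polarPoint x (r, θ))‖) ^ 2 := by
      rw [intervalIntegral.integral_const_mul, mul_pow]
    _ ≤ r ^ 2 * ((Real.pi - -Real.pi) *
        ∫ θ in -Real.pi..Real.pi, ‖fderiv ℝ f (polarPoint x (r, θ))‖ ^ 2) := by
      gcongr
      exact sq_intervalIntegral_le hcont hpi
    _ = _ := by ring

/-- Integration over a disc in polar coordinates. -/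
lemma setLIntegral_ball_polar (x : E2) (R : ℝ) {h : E2 → ENNReal} (hh : Measurable h) :
    ∫⁻ r in Ioo 0 R, ∫⁻ θ in Ioo (-Real.pi) Real.pi,
      ENNReal.ofReal r * h (polarPoint x (r, θ)) = ∫⁻ y in ball x R, h y := by
  set g : E2 → ENNReal := (ball x R).indicator h with hg
  have hgm : Measurable g := hh.indicator measurableSet_ball
  have h1 : ∫⁻ y in ball x R, h y = ∫⁻ z : ℂ, g (x + Complex.orthonormalBasisOneI.repr z) := by
    rw [(OrthonormalBasis.measurePreserving_repr Complex.orthonormalBasisOneI).lintegral_comp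
      (f := fun y => g (x + y)) (hgm.comp (measurable_const_add x)),
      lintegral_add_left_eq_self g x, hg, lintegral_indicator measurableSet_ball]
  have hpm : Measurable (polarPoint x) := (continuous_polarPoint x).measurable
  rw [h1, ← Complex.lintegral_comp_polarCoord_symm, polarCoord_target,
    Measure.volume_eq_prod, ← Measure.prod_restrict, lintegral_prod _ ?_]
  · have h2 : Ioo 0 R = Iio R ∩ Ioi 0 := by
      ext r
      simp [and_comm]
    rw [h2, ← Measure.restrict_restrict measurableSet_Iio, ← lintegral_indicator measurableSet_Iio]
    refine setLIntegral_congr_fun measurableSet_Ioi fun r hr => ?_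
    have h3 : ∀ θ, polarPoint x (r, θ) ∈ ball x R ↔ r < R := fun θ => by
      rw [mem_ball, dist_polarPoint, abs_of_pos hr]
    by_cases hR : r < R
    · rw [indicator_of_mem (show r ∈ Iio R from hR)]
      refine lintegral_congr fun θ => ?_
      change _ = _ * g (polarPoint x (r, θ))
      rw [hg, indicator_of_mem ((h3 θ).2 hR)]
    · rw [indicator_of_notMem (show r ∉ Iio R from hR)]
      symm
      refine (lintegral_congr fun θ => ?_).trans lintegral_zero
      change _ * g (polarPoint x (r, θ)) = 0
      rw [hg, indicator_of_notMem fun hm => hR ((h3 θ).1 hm), mul_zero]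
  · exact ((measurable_fst.ennreal_ofReal).mul (hgm.comp hpm)).aemeasurable

/-- The Courant–Lebesgue estimate for functions monotone in the sense of Lebesgue. -/
lemma sq_osc_closedBall_mul_log_le {G : Set E2} (hG : IsOpen G) {f : E2 → ℝ}
    (hf : ContDiffOn ℝ 1 f G) {x : E2} {δ R : ℝ} (hδ : 0 < δ) (hδR : δ < R)
    (hxR : closedBall x R ⊆ G)
    (hmono : ∀ r ∈ Ioo 0 R, osc f (sphere x r) = osc f (closedBall x r)) :
    osc f (closedBall x δ) ^ 2 * Real.log (R / δ) ≤
      2 * Real.pi * ∫ y in ball x R, ‖fderiv ℝ f y‖ ^ 2 := by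
  have hR : 0 < R := hδ.trans hδR
  set s := osc f (closedBall x δ) with hs
  have hs0 : 0 ≤ s := by
    have := (isCompact_closedBall x δ).abs_sub_le_osc
      (hf.continuousOn.mono ((closedBall_subset_closedBall hδR.le).trans hxR))
      (mem_closedBall_self hδ.le) (mem_closedBall_self hδ.le)
    exact (abs_nonneg _).trans this
  have hint : IntegrableOn (fun y => ‖fderiv ℝ f y‖ ^ 2) (ball x R) :=
    (((((hf.continuousOn_fderiv_of_isOpen hG le_rfl).mono hxR).norm).pow 2).integrableOn_compact
      (isCompact_closedBall x R)).mono_set ball_subset_closedBall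
  have hpt : ∀ r ∈ Ioo δ R, ENNReal.ofReal (s ^ 2 * (1 / r)) ≤
      ENNReal.ofReal (2 * Real.pi) * ∫⁻ θ in Ioo (-Real.pi) Real.pi,
        ENNReal.ofReal r * ENNReal.ofReal (‖fderiv ℝ f (polarPoint x (r, θ))‖ ^ 2) := by
    intro r hr
    have hr0 : 0 < r := hδ.trans hr.1
    have hsub : closedBall x r ⊆ G := (closedBall_subset_closedBall hr.2.le).trans hxR
    have hmem : ∀ θ, polarPoint x (r, θ) ∈ G := fun θ => hsub <| by
      rw [mem_closedBall, dist_polarPoint, abs_of_pos hr0]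
    have hcont : Continuous fun θ => ‖fderiv ℝ f (polarPoint x (r, θ))‖ ^ 2 :=
      (((hf.continuousOn_fderiv_of_isOpen hG le_rfl).comp_continuous
        ((continuous_polarPoint x).comp (by fun_prop)) hmem).norm).pow 2
    have h1 : s ≤ osc f (sphere x r) := by
      rw [hmono r ⟨hr0, hr.2⟩]
      exact (isCompact_closedBall x r).osc_mono (isCompact_closedBall x δ)
        (nonempty_closedBall.2 hδ.le) (closedBall_subset_closedBall hr.1.le)
        (hf.continuousOn.mono hsub)
    have h2 : s ^ 2 * (1 / r) ≤ 2 * Real.pi * (r *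
        ∫ θ in -Real.pi..Real.pi, ‖fderiv ℝ f (polarPoint x (r, θ))‖ ^ 2) := by
      rw [mul_one_div, div_le_iff₀ hr0]
      refine (pow_le_pow_left₀ hs0 h1 2).trans ((sq_osc_sphere_le hG hf hr0 hsub).trans_eq ?_)
      ring
    refine (ENNReal.ofReal_le_ofReal h2).trans_eq ?_
    rw [ENNReal.ofReal_mul (by positivity), ENNReal.ofReal_mul hr0.le,
      lintegral_const_mul' _ _ ENNReal.ofReal_ne_top,
      intervalIntegral.integral_of_le (by linarith [Real.pi_pos]), integral_Ioc_eq_integral_Ioo,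
      ofReal_integral_eq_lintegral_ofReal]
    · exact (hcont.integrableOn_Icc).mono_set Ioo_subset_Icc_self
    · exact Filter.Eventually.of_forall fun θ => by dsimp; positivity
  have hlog : ENNReal.ofReal (s ^ 2 * Real.log (R / δ))
      = ∫⁻ r in Ioo δ R, ENNReal.ofReal (s ^ 2 * (1 / r)) := by
    have hcont : ContinuousOn (fun r : ℝ => s ^ 2 * (1 / r)) (Icc δ R) :=
      continuousOn_const.mul (continuousOn_const.div continuousOn_id
        fun r hr => (hδ.trans_le hr.1).ne')
    rw [← integral_one_div_of_pos hδ hR, ← intervalIntegral.integral_const_mul,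
      intervalIntegral.integral_of_le hδR.le, integral_Ioc_eq_integral_Ioo,
      ofReal_integral_eq_lintegral_ofReal]
    · exact (hcont.integrableOn_Icc).mono_set Ioo_subset_Icc_self
    · refine (ae_restrict_mem measurableSet_Ioo).mono fun r hr => ?_
      have : 0 < r := hδ.trans hr.1
      dsimp
      positivity
  have hnn : 0 ≤ ∫ y in ball x R, ‖fderiv ℝ f y‖ ^ 2 := integral_nonneg fun y => by positivity
  rw [← ENNReal.ofReal_le_ofReal_iff (by positivity), hlog, ENNReal.ofReal_mul (by positivity),
    ofReal_integral_eq_lintegral_ofReal hint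
      (Filter.Eventually.of_forall fun y => by dsimp; positivity),
    ← setLIntegral_ball_polar x R (h := fun y => ENNReal.ofReal (‖fderiv ℝ f y‖ ^ 2))
      (((measurable_fderiv ℝ f).norm.pow_const 2).ennreal_ofReal),
    ← lintegral_const_mul' _ _ ENNReal.ofReal_ne_top]
  exact (setLIntegral_mono' measurableSet_Ioo hpt).trans
    (lintegral_mono_set (Ioo_subset_Ioo_left hδ.le))

/-- **Equicontinuity from uniformly bounded Dirichlet integrals.** A family of `C¹`
functions on an open set `G ⊆ ℝ²`, each monotone in the sense of Lebesgue on every closed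
disc contained in `G`, with locally uniformly bounded Dirichlet integrals, is
equicontinuous on every compact subset of `G`. -/
theorem equicontinuity_of_monotone_bounded_dirichlet
    (G : Set E2) (hG : IsOpen G) (F : Set (E2 → ℝ))
    (hC1 : ∀ f ∈ F, ContDiffOn ℝ 1 f G)
    (hmono : ∀ f ∈ F, ∀ (x₀ : E2) (R : ℝ), 0 < R → closedBall x₀ R ⊆ G →
      ∀ r ∈ Ioo (0 : ℝ) R, osc f (sphere x₀ r) = osc f (closedBall x₀ r))
    (hbound : ∀ D : Set E2, IsOpen D → IsCompact (closure D) → closure D ⊆ G →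
      ∃ M : ℝ, ∀ f ∈ F, (∫ x in D, ‖gradient f x‖ ^ 2) ≤ M) :
    ∀ D : Set E2, IsCompact D → D ⊆ G → ∀ ε : ℝ, 0 < ε → ∃ δ : ℝ, 0 < δ ∧
      ∀ f ∈ F, ∀ x ∈ D, ∀ y ∈ D, dist x y < δ → |f x - f y| < ε := by
  intro D hD hDG ε hε
  obtain ⟨R, hR, hRG⟩ := hD.exists_cthickening_subset_open hG hDG
  have hcl : closure (thickening R D) ⊆ cthickening R D := closure_thickening_subset_cthickening R D
  obtain ⟨M, hM⟩ := hbound (thickening R D) isOpen_thickening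
    (hD.cthickening.of_isClosed_subset isClosed_closure hcl) (hcl.trans hRG)
  set A := 2 * Real.pi * |M| with hA
  have hA0 : 0 ≤ A := by positivity
  have hL : 0 < (A + 1) / ε ^ 2 := by positivity
  set δ := R * Real.exp (-((A + 1) / ε ^ 2)) with hδ
  have hδ0 : 0 < δ := by positivity
  have hδR : δ < R := mul_lt_of_lt_one_right hR (by simpa using hL)
  have hlog : Real.log (R / δ) = (A + 1) / ε ^ 2 := by
    rw [hδ, ← div_div, div_self hR.ne', one_div, ← Real.exp_neg, neg_neg, Real.log_exp]
  refine ⟨δ, hδ0, fun f hf x hx y hy hxy => ?_⟩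
  have hball : closedBall x R ⊆ G := (closedBall_subset_cthickening hx R).trans hRG
  have hfδ : ContinuousOn f (closedBall x δ) :=
    (hC1 f hf).continuousOn.mono ((closedBall_subset_closedBall hδR.le).trans hball)
  have hosc := (isCompact_closedBall x δ).abs_sub_le_osc hfδ (mem_closedBall_self hδ0.le)
    (mem_closedBall'.2 hxy.le)
  refine hosc.trans_lt (lt_of_pow_lt_pow_left₀ 2 hε.le ?_)
  have hgrad : ∀ z, ‖gradient f z‖ = ‖fderiv ℝ f z‖ := fun z => by simp [gradient]
  have hle : ∫ z in ball x R, ‖fderiv ℝ f z‖ ^ 2 ≤ |M| := by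
    have h := hM f hf
    simp_rw [hgrad] at h
    refine (setIntegral_mono_set ?_ (Filter.Eventually.of_forall fun z => by dsimp; positivity)
      (ball_subset_thickening hx R).eventuallyLE).trans (h.trans (le_abs_self M))
    exact (((((hC1 f hf).continuousOn_fderiv_of_isOpen hG le_rfl).mono
      hRG).norm.pow 2).integrableOn_compact hD.cthickening).mono_set
      (thickening_subset_cthickening R D)
  have hmain := sq_osc_closedBall_mul_log_le hG (hC1 f hf) hδ0 hδR hball (hmono f hf x R hR hball)
  rw [hlog] at hmain
  have hfin : osc f (closedBall x δ) ^ 2 * ((A + 1) / ε ^ 2) ≤ A :=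
    hmain.trans (by rw [hA]; gcongr)
  rw [← mul_div_assoc, div_le_iff₀ (by positivity)] at hfin
  nlinarith [pow_pos hε 2]
end
end

section
/- Let p > 2 and let u ∈ C²(U) satisfy the p-Laplace equation (p−2)·Δ∞u + |∇u|²·Δu = 0 together with Δu ≤ 0 everywhere in U. If α : I → U is differentiable on an interval I and α'(t) = ∇u(α(t)) for all t ∈ I, then the function t ↦ u(α(t)) is convex on I; in particular t ↦ |∇u(α(t))| is non-decreasing on I. -/
open Set Metric
open scoped RealInnerProductSpace

noncomputable section

/-- The ∞-Laplacian `Δ∞v(x) = ⟨D²v(x)∇v(x), ∇v(x)⟩`. -/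
def lapInf (v : E2 → ℝ) (x : E2) : ℝ :=
  ⟪fderiv ℝ (gradient v) x (gradient v x), gradient v x⟫

/-- The Laplacian `Δv(x)`, as the trace of the Hessian `D²v(x)`. -/
def lap (v : E2 → ℝ) (x : E2) : ℝ :=
  LinearMap.trace ℝ E2 (fderiv ℝ (gradient v) x : E2 →ₗ[ℝ] E2)

theorem ContDiffOn.differentiableAt_gradient {F : Type*} [NormedAddCommGroup F]
    [InnerProductSpace ℝ F] [CompleteSpace F] {u : F → ℝ} {U : Set F} (hU : IsOpen U)
    (hu : ContDiffOn ℝ 2 u U) {x : F} (hx : x ∈ U) : DifferentiableAt ℝ (gradient u) x := by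
  have h : DifferentiableAt ℝ (fderiv ℝ u) x :=
    ((hu.fderiv_of_isOpen hU (m := 1) (by norm_num)).contDiffAt
      (hU.mem_nhds hx)).differentiableAt one_ne_zero
  exact (InnerProductSpace.toDual ℝ F).symm.toContinuousLinearEquiv.differentiableAt.comp x h

theorem lapInf_nonneg_of_pLaplace {p : ℝ} (hp : 2 < p) {u : E2 → ℝ} {x : E2}
    (hharm : (p - 2) * lapInf u x + ‖gradient u x‖ ^ 2 * lap u x = 0)
    (hsub : lap u x ≤ 0) : 0 ≤ lapInf u x := by
  have h := mul_nonpos_of_nonneg_of_nonpos (sq_nonneg ‖gradient u x‖) hsub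
  exact nonneg_of_mul_nonneg_right (by linarith) (sub_pos.2 hp)

/-- If `u ∈ C²(U)` satisfies the `p`-Laplace equation `(p−2)Δ∞u + |∇u|²Δu = 0` and `Δu ≤ 0`
in `U`, then `t ↦ u(α(t))` is convex along any streamline `α` of `u`; in particular the
speed `t ↦ |∇u(α(t))|` is non-decreasing. -/
theorem convex_along_streamline_of_pLaplace
    (U : Set E2) (hU : IsOpen U) (p : ℝ) (hp : 2 < p) (u : E2 → ℝ)
    (hu : ContDiffOn ℝ 2 u U)
    (hharm : ∀ x ∈ U, (p - 2) * lapInf u x + ‖gradient u x‖ ^ 2 * lap u x = 0)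
    (hsub : ∀ x ∈ U, lap u x ≤ 0)
    (I : Set ℝ) (hI : I.OrdConnected) (α : ℝ → E2)
    (hmem : ∀ t ∈ I, α t ∈ U)
    (hode : ∀ t ∈ I, HasDerivWithinAt α (gradient u (α t)) I t) :
    ConvexOn ℝ I (fun t => u (α t)) ∧
      MonotoneOn (fun t => ‖gradient u (α t)‖) I := by
  have hconv : Convex ℝ I := hI.convex
  have hspeed : ∀ t ∈ I,
      HasDerivWithinAt (fun t => ‖gradient u (α t)‖ ^ 2) (2 * lapInf u (α t)) I t := by
    intro t ht
    have h := ((hu.differentiableAt_gradient hU (hmem t ht)).hasFDerivAt.comp_hasDerivWithinAt t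
      (hode t ht)).norm_sq
    rwa [real_inner_comm] at h
  have hderiv : ∀ t ∈ I, HasDerivWithinAt (fun t => u (α t)) (‖gradient u (α t)‖ ^ 2) I t := by
    intro t ht
    have hd : DifferentiableAt ℝ u (α t) :=
      (hu.contDiffAt (hU.mem_nhds (hmem t ht))).differentiableAt two_ne_zero
    have h := hd.hasGradientAt.hasFDerivAt.comp_hasDerivWithinAt t (hode t ht)
    rwa [InnerProductSpace.toDual_apply_apply, real_inner_self_eq_norm_sq] at h
  have hmono : MonotoneOn (fun t => ‖gradient u (α t)‖ ^ 2) I :=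
    monotoneOn_of_hasDerivWithinAt_nonneg hconv (fun t ht => (hspeed t ht).continuousWithinAt)
      (fun t ht => (hspeed t (interior_subset ht)).mono interior_subset) fun t ht =>
      have hx := hmem t (interior_subset ht)
      mul_nonneg zero_le_two (lapInf_nonneg_of_pLaplace hp (hharm _ hx) (hsub _ hx))
  refine ⟨MonotoneOn.convexOn_of_deriv hconv (fun t ht => (hderiv t ht).continuousWithinAt)
    (fun t ht => ((hderiv t (interior_subset ht)).mono interior_subset).differentiableWithinAt)
    ((hmono.mono interior_subset).congr fun t ht => ?_), fun s hs t ht hst => ?_⟩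
  · exact ((hderiv t (interior_subset ht)).hasDerivAt
      (mem_interior_iff_mem_nhds.1 ht)).deriv.symm
  · exact (sq_le_sq₀ (norm_nonneg _) (norm_nonneg _)).1 (hmono hs ht hst)
end
end
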